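/- For all integers n ≥ k ≥ 1, the binomial coefficient C(n, k) equals the alternating sum ∑_{i=0}^{k} (-1)^i · C(n+1+i, k-i) · Cat(i), where Cat(i) denotes the i-th Catalan number. -/

import Mathlib

open Finset

namespace PowerSeries

/-- The Catalan generating function with integer coefficients. -/
noncomputable def intCatalanSeries : ℤ⟦X⟧ :=
  map (Nat.castRingHom ℤ) catalanSeries

theorem intCatalanSeries_sq_mul_X_add_one :
    intCatalanSeries ^ 2 * X + 1 = intCatalanSeries := by
  simpa [intCatalanSeries] using
    congrArg (map (Nat.castRingHom ℤ)) catalanSeries_sq_mul_X_add_one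

theorem hasSubst_neg_X_mul_one_add_X : HasSubst (-(X * (1 + X)) : ℤ⟦X⟧) :=
  HasSubst.of_constantCoeff_zero' (by simp)

/-- Substituting `-X (1 + X)` into the Catalan series gives the inverse of `1 + X`. -/
theorem one_add_X_mul_subst_intCatalanSeries :
    (1 + X) * intCatalanSeries.subst (-(X * (1 + X)) : ℤ⟦X⟧) = 1 := by
  have hs := hasSubst_neg_X_mul_one_add_X
  have h := congrArg (substAlgHom (R := ℤ) hs) intCatalanSeries_sq_mul_X_add_one
  rw [map_add, map_mul, map_pow, map_one, substAlgHom_X, coe_substAlgHom] at h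
  set f : ℤ⟦X⟧ := intCatalanSeries.subst (-(X * (1 + X)) : ℤ⟦X⟧)
  have hfactor : ((1 + X) * f - 1) * (1 + X * f) = 0 := by linear_combination -h
  have hne : (1 + X * f) ≠ 0 := fun h0 => by
    simpa using congrArg constantCoeff h0
  exact sub_eq_zero.mp ((mul_eq_zero.mp hfactor).resolve_right hne)

theorem subst_eq_sum_add_pow_mul {R : Type*} [CommRing R] {a : R⟦X⟧} (ha : HasSubst a)
    (f : R⟦X⟧) (k : ℕ) :
    ∃ r : R⟦X⟧, f.subst a = ∑ i ∈ range k, C (coeff i f) * a ^ i + a ^ k * r := by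
  refine ⟨(mk fun i => coeff (i + k) f).subst a, ?_⟩
  have h := congrArg (substAlgHom (R := R) ha) (f.eq_X_pow_mul_shift_add_trunc k)
  rw [map_add, map_mul, map_pow, substAlgHom_X, substAlgHom_coe, coe_substAlgHom] at h
  rw [h, add_comm]
  congr 1
  rw [trunc_apply, map_sum, Nat.Ico_zero_eq_range]
  refine sum_congr rfl fun i _ => ?_
  rw [Polynomial.aeval_monomial]
  rfl

theorem coeff_one_add_X_pow {R : Type*} [CommRing R] (n k : ℕ) :
    coeff k ((1 + X : R⟦X⟧) ^ n) = n.choose k := by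
  have h := Polynomial.coeff_one_add_X_pow R n k
  rw [← Polynomial.coeff_coe] at h
  simpa using h

end PowerSeries

open PowerSeries in
theorem binomial_catalan_alternating_sum (n k : ℕ) (hk : 1 ≤ k) (hkn : k ≤ n) :
    (n.choose k : ℤ) =
      ∑ i ∈ Finset.range (k + 1),
        (-1) ^ i * ((n + 1 + i).choose (k - i) : ℤ) * (catalan i : ℤ) := by
  obtain ⟨r, hr⟩ :=
    subst_eq_sum_add_pow_mul hasSubst_neg_X_mul_one_add_X intCatalanSeries (k + 1)
  have hinv := one_add_X_mul_subst_intCatalanSeries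
  rw [hr] at hinv
  have hexp : (1 + X : ℤ⟦X⟧) ^ n =
      ∑ i ∈ range (k + 1), C ((-1) ^ i * (catalan i : ℤ)) * (X ^ i * (1 + X) ^ (n + 1 + i)) +
        X ^ (k + 1) * ((-(1 + X)) ^ (k + 1) * r * (1 + X) ^ (n + 1)) := by
    calc (1 + X : ℤ⟦X⟧) ^ n = (1 + X) ^ n * ((1 + X) * _) := by rw [hinv, mul_one]
      _ = _ := by
        rw [← mul_assoc, ← pow_succ, mul_add, mul_sum]
        congr 1
        · refine sum_congr rfl fun i _ => ?_
          rw [neg_pow, mul_pow, pow_add _ (n + 1) i]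
          simp only [intCatalanSeries, coeff_map, catalanSeries_coeff, map_mul, map_pow, map_neg,
            map_one, Nat.coe_castRingHom]
          ring
        · rw [← mul_neg, mul_pow]
          ring
  rw [← coeff_one_add_X_pow, hexp, map_add, map_sum, coeff_X_pow_mul', if_neg (by lia), add_zero]
  refine sum_congr rfl fun i hi => ?_
  rw [coeff_C_mul, coeff_X_pow_mul', if_pos (by simpa [Nat.lt_succ_iff] using hi),
    coeff_one_add_X_pow]
  ring
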